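/- arXiv:1608.05395 — 8 statements merged into one kernel-verified Lean document; each statement's English description precedes it below -/
import Mathlib

section
/- Let N ≥ 2 and let U belong to the class 𝒰_N, i.e. U is a real orthogonal N×N matrix and there exist vectors p, q ∈ ℝᴺ such that U − p qᵀ is upper triangular. Then for every k with 1 ≤ k ≤ N−1, the submatrix U(1:k, k+1:N) of the strictly upper triangular part has rank at most 1. -/
open scoped Matrix

namespace Matrix

/-- For square matrices over a field, `1 - A * B` has rank at most that of `1 - B * A`. -/
theorem rank_one_sub_mul_le {K n : Type*} [Field K] [Fintype n] [DecidableEq n]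
    (A B : Matrix n n K) : (1 - A * B).rank ≤ (1 - B * A).rank := by
  have hker : Module.finrank K (LinearMap.ker (1 - B * A).mulVecLin) ≤
      Module.finrank K (LinearMap.ker (1 - A * B).mulVecLin) := by
    have hfix : ∀ x ∈ LinearMap.ker (1 - B * A).mulVecLin, B *ᵥ (A *ᵥ x) = x := by
      intro x hx
      rw [LinearMap.mem_ker, mulVecLin_apply, sub_mulVec, one_mulVec, sub_eq_zero] at hx
      rw [mulVec_mulVec, ← hx]
    have hmap : ∀ x ∈ LinearMap.ker (1 - B * A).mulVecLin,
        A.mulVecLin x ∈ LinearMap.ker (1 - A * B).mulVecLin := by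
      intro x hx
      rw [LinearMap.mem_ker, mulVecLin_apply, mulVecLin_apply, sub_mulVec, one_mulVec,
        ← mulVec_mulVec, hfix x hx, sub_self]
    refine LinearMap.finrank_le_finrank_of_injective (f := A.mulVecLin.restrict hmap) ?_
    intro x y hxy
    have h : A *ᵥ (x : n → K) = A *ᵥ (y : n → K) := congrArg Subtype.val hxy
    exact Subtype.ext (by rw [← hfix x x.2, h, hfix y y.2])
  have h₁ := LinearMap.finrank_range_add_finrank_ker (1 - A * B).mulVecLin
  have h₂ := LinearMap.finrank_range_add_finrank_ker (1 - B * A).mulVecLin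
  simp only [rank]
  omega

/-- The off-diagonal blocks of a real orthogonal matrix, partitioned with square diagonal blocks,
satisfy `rank V₁₂ ≤ rank V₂₁`. -/
theorem rank_toBlocks₁₂_le_of_orthogonal {m n : Type*} [Fintype m] [Fintype n]
    [DecidableEq m] [DecidableEq n] {V : Matrix (m ⊕ n) (m ⊕ n) ℝ} (hV : Vᵀ * V = 1) :
    V.toBlocks₁₂.rank ≤ V.toBlocks₂₁.rank := by
  have hV' : V * Vᵀ = 1 := mul_eq_one_comm.mp hV
  rw [← fromBlocks_toBlocks V, fromBlocks_transpose, fromBlocks_multiply, ← fromBlocks_one,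
    fromBlocks_inj] at hV hV'
  rw [← rank_self_mul_transpose V.toBlocks₁₂, ← rank_transpose_mul_self V.toBlocks₂₁,
    eq_sub_of_add_eq' hV'.1, eq_sub_of_add_eq' hV.1]
  exact rank_one_sub_mul_le _ _

end Matrix

/-- If `U` is a real orthogonal matrix such that `U - p qᵀ` is upper triangular
for some vectors `p, q` (i.e. `U ∈ 𝒰_N`), then for every `1 ≤ k ≤ N-1` the
submatrix `U(1:k, k+1:N)` has rank at most one. -/
theorem upper_submatrix_rank_le_one_of_class_U
    (N : ℕ) (hN : 2 ≤ N) (U : Matrix (Fin N) (Fin N) ℝ)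
    (hU : Uᵀ * U = 1)
    (hUclass : ∃ p q : Fin N → ℝ,
      ∀ i j : Fin N, j < i → (U - Matrix.vecMulVec p q) i j = 0)
    (k : ℕ) (hk1 : 1 ≤ k) (hk2 : k ≤ N - 1) :
    (U.submatrix (fun i : Fin k => Fin.castLE (by omega) i)
        (fun j : Fin (N - k) => (⟨k + (j : ℕ), by have := j.isLt; omega⟩ : Fin N))).rank ≤ 1 := by
  obtain ⟨p, q, hpq⟩ := hUclass
  let e : Fin k ⊕ Fin (N - k) ≃ Fin N := finSumFinEquiv.trans (finCongr (by omega))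
  have hV : (U.submatrix e e)ᵀ * U.submatrix e e = 1 := by
    rw [Matrix.transpose_submatrix, Matrix.submatrix_mul_equiv, hU, Matrix.submatrix_one_equiv]
  have hlow : (U.submatrix e e).toBlocks₂₁ =
      Matrix.vecMulVec (fun i => p (e (Sum.inr i))) (fun j => q (e (Sum.inl j))) := by
    ext i j
    refine sub_eq_zero.mp (hpq (e (Sum.inr i)) (e (Sum.inl j)) ?_)
    simp only [e, Fin.lt_def, Equiv.trans_apply, finSumFinEquiv_apply_left,
      finSumFinEquiv_apply_right, finCongr_apply, Fin.val_cast, Fin.val_castAdd, Fin.val_natAdd]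
    omega
  calc _ = (U.submatrix e e).toBlocks₁₂.rank := rfl
    _ ≤ (U.submatrix e e).toBlocks₂₁.rank := Matrix.rank_toBlocks₁₂_le_of_orthogonal hV
    _ ≤ 1 := hlow ▸ Matrix.rank_vecMulVec_le _ _
end

section
/- Let N ≥ 1 and let V belong to the class 𝒱_N, i.e. V is a real orthogonal N×N matrix and there exist vectors z, w ∈ ℝᴺ such that V − z wᵀ is upper Hessenberg. Then for every k with 1 ≤ k ≤ N, the submatrix V(1:k, k:N) (rows 1 through k, columns k through N, which includes the diagonal entry V(k,k)) has rank at most 2. -/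
open scoped Matrix

/-- One direction of the nullity theorem: complementary blocks of a matrix and its left inverse. -/
theorem rank_toBlock_compl_add_card_le {K m n : Type*} [Field K] [Fintype m] [Fintype n]
    [DecidableEq n] {U : Matrix n m K} {V : Matrix m n K} (h : U * V = 1)
    (p : m → Prop) (q : n → Prop) [DecidablePred p] [DecidablePred q] :
    (U.toBlock (fun j => ¬ q j) p).rank + Fintype.card {j // q j} ≤
      Fintype.card {i // p i} + (V.toBlock (fun i => ¬ p i) q).rank := by
  have hone : U.toBlock q p * V.toBlock p q +
      U.toBlock q (fun i => ¬ p i) * V.toBlock (fun i => ¬ p i) q = 1 := by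
    rw [← Matrix.toBlock_mul_eq_add, h, Matrix.toBlock_one_self]
  have hzero : U.toBlock (fun j => ¬ q j) p * V.toBlock p q +
      U.toBlock (fun j => ¬ q j) (fun i => ¬ p i) * V.toBlock (fun i => ¬ p i) q = 0 := by
    rw [← Matrix.toBlock_mul_eq_add, h, Matrix.toBlock_one_disjoint]
    exact disjoint_compl_left
  set A := V.toBlock (fun i => ¬ p i) q
  set B := U.toBlock (fun j => ¬ q j) p
  set E := V.toBlock p q
  have hmaps : ∀ x ∈ LinearMap.ker A.mulVecLin, E.mulVecLin x ∈ LinearMap.ker B.mulVecLin := by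
    intro x hx
    simp only [LinearMap.mem_ker, Matrix.mulVecLin_apply] at hx ⊢
    have := congrArg (· *ᵥ x) hzero
    simpa [Matrix.add_mulVec, ← Matrix.mulVec_mulVec, hx] using this
  have hinj : Function.Injective (E.mulVecLin.restrict hmaps) := by
    rw [← LinearMap.ker_eq_bot, LinearMap.ker_eq_bot']
    rintro ⟨x, hx⟩ hEx
    have hEx' : E *ᵥ x = 0 := congrArg Subtype.val hEx
    simp only [LinearMap.mem_ker, Matrix.mulVecLin_apply] at hx
    have := congrArg (· *ᵥ x) hone
    simp only [Matrix.add_mulVec, ← Matrix.mulVec_mulVec, hx, hEx', Matrix.mulVec_zero,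
      add_zero, Matrix.one_mulVec] at this
    exact Subtype.ext this.symm
  have hker := LinearMap.finrank_le_finrank_of_injective hinj
  have hA := A.mulVecLin.finrank_range_add_finrank_ker
  have hB := B.mulVecLin.finrank_range_add_finrank_ker
  rw [Module.finrank_fintype_fun_eq_card] at hA hB
  unfold Matrix.rank
  omega

/-- If `V` is a real orthogonal matrix such that `V - z wᵀ` is upper Hessenberg
for some vectors `z, w` (i.e. `V ∈ 𝒱_N`), then for every `1 ≤ k ≤ N` the
submatrix `V(1:k, k:N)` (including the diagonal entry `V(k,k)`) has rank at
most two. -/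
theorem upper_submatrix_rank_le_two_of_class_V
    (N : ℕ) (hN : 1 ≤ N) (V : Matrix (Fin N) (Fin N) ℝ)
    (hV : Vᵀ * V = 1)
    (hVclass : ∃ z w : Fin N → ℝ,
      ∀ i j : Fin N, (j : ℕ) + 1 < (i : ℕ) → (V - Matrix.vecMulVec z w) i j = 0)
    (k : ℕ) (hk1 : 1 ≤ k) (hk2 : k ≤ N) :
    (V.submatrix (fun i : Fin k => Fin.castLE (by omega) i)
        (fun j : Fin (N - (k - 1)) =>
          (⟨k - 1 + (j : ℕ), by have := j.isLt; omega⟩ : Fin N))).rank ≤ 2 := by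
  obtain ⟨z, w, hzw⟩ := hVclass
  have hnull := rank_toBlock_compl_add_card_le hV (fun i => (i : ℕ) < k) (fun j => (j : ℕ) < k - 1)
  have hlow : (V.toBlock (fun i => ¬ (i : ℕ) < k) (fun j => (j : ℕ) < k - 1)).rank ≤ 1 := by
    have : V.toBlock (fun i => ¬ (i : ℕ) < k) (fun j => (j : ℕ) < k - 1) =
        Matrix.vecMulVec (fun i => z i.1) (fun j => w j.1) := by
      ext ⟨i, hi⟩ ⟨j, hj⟩
      exact sub_eq_zero.mp (hzw i j (by omega))
    rw [this]
    exact Matrix.rank_vecMulVec_le _ _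
  have hcard : ∀ l ≤ N, Fintype.card {i : Fin N // (i : ℕ) < l} = l := by
    intro l hl
    rw [Fintype.card_subtype, Fin.card_filter_val_lt, min_eq_right hl]
  rw [hcard k hk2, hcard (k - 1) (by omega), ← Matrix.rank_transpose] at hnull
  have hsub := Matrix.rank_submatrix_le
    (Vᵀ.toBlock (fun j => ¬ (j : ℕ) < k - 1) (fun i => (i : ℕ) < k))ᵀ
    (fun i : Fin k => ⟨Fin.castLE hk2 i, i.isLt⟩)
    (fun j : Fin (N - (k - 1)) => ⟨⟨k - 1 + (j : ℕ), by omega⟩, by simp⟩)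
  exact hsub.trans (by omega)
end

section
/- Let (A,B) belong to the class 𝒫_N, with A = V − z wᵀ for an orthogonal matrix V and vectors z, w ∈ ℝᴺ, and B = U − p qᵀ for an orthogonal matrix U and vectors p, q ∈ ℝᴺ. Let Q and Z be real orthogonal N×N matrices such that A₁ = Qᵀ A Z is upper Hessenberg and B₁ = Qᵀ B Z is upper triangular. Then (A₁, B₁) belongs to 𝒫_N; specifically, A₁ = V₁ − z₁ w₁ᵀ and B₁ = U₁ − p₁ q₁ᵀ, where V₁ = Qᵀ V Z and U₁ = Qᵀ U Z are orthogonal and z₁ = Qᵀ z, w₁ = Zᵀ w, p₁ = Qᵀ p, q₁ = Zᵀ q. -/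
open scoped Matrix

theorem Matrix.transpose_mul_self_conj_eq_one {n R : Type*} [Fintype n] [DecidableEq n]
    [CommRing R] {Q M Z : Matrix n n R}
    (hQ : Qᵀ * Q = 1) (hM : Mᵀ * M = 1) (hZ : Zᵀ * Z = 1) :
    (Qᵀ * M * Z)ᵀ * (Qᵀ * M * Z) = 1 := by
  have hQ' : Q * Qᵀ = 1 := mul_eq_one_comm.mp hQ
  calc (Qᵀ * M * Z)ᵀ * (Qᵀ * M * Z) = Zᵀ * (Mᵀ * (Q * Qᵀ) * M) * Z := by
        simp only [Matrix.transpose_mul, Matrix.transpose_transpose, Matrix.mul_assoc]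
    _ = 1 := by rw [hQ', Matrix.mul_one, hM, Matrix.mul_one, hZ]

theorem Matrix.mul_sub_vecMulVec_mul {l m n o R : Type*} [Fintype m] [Fintype n]
    [CommRing R] (P : Matrix l m R) (M : Matrix m n R) (Z : Matrix n o R)
    (x : m → R) (y : n → R) :
    P * (M - Matrix.vecMulVec x y) * Z =
      P * M * Z - Matrix.vecMulVec (P.mulVec x) (Zᵀ.mulVec y) := by
  rw [Matrix.mul_sub, Matrix.sub_mul, Matrix.mul_vecMulVec, Matrix.vecMulVec_mul,
    Matrix.mulVec_transpose]

/-- Structural invariance of the class `𝒫_N` under a QZ step: if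
`A = V - z wᵀ` is upper Hessenberg, `B = U - p qᵀ` is upper triangular, with
`V, U` orthogonal, and `Q, Z` are orthogonal matrices such that `A₁ = QᵀAZ` is
upper Hessenberg and `B₁ = QᵀBZ` is upper triangular, then `(A₁, B₁) ∈ 𝒫_N`:
`A₁ = V₁ - z₁ w₁ᵀ` and `B₁ = U₁ - p₁ q₁ᵀ` with `V₁ = QᵀVZ`, `U₁ = QᵀUZ`
orthogonal and `z₁ = Qᵀz`, `w₁ = Zᵀw`, `p₁ = Qᵀp`, `q₁ = Zᵀq`. -/
theorem class_P_invariant_under_QZ_step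
    (N : ℕ) (A B V U Q Z : Matrix (Fin N) (Fin N) ℝ)
    (z w p q : Fin N → ℝ)
    (hAHess : ∀ i j : Fin N, (j : ℕ) + 1 < (i : ℕ) → A i j = 0)
    (hBtri : ∀ i j : Fin N, j < i → B i j = 0)
    (hV : Vᵀ * V = 1) (hU : Uᵀ * U = 1)
    (hA : A = V - Matrix.vecMulVec z w)
    (hB : B = U - Matrix.vecMulVec p q)
    (hQ : Qᵀ * Q = 1) (hZ : Zᵀ * Z = 1)
    (hA1Hess : ∀ i j : Fin N, (j : ℕ) + 1 < (i : ℕ) → (Qᵀ * A * Z) i j = 0)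
    (hB1tri : ∀ i j : Fin N, j < i → (Qᵀ * B * Z) i j = 0) :
    (Qᵀ * V * Z)ᵀ * (Qᵀ * V * Z) = 1 ∧
    (Qᵀ * U * Z)ᵀ * (Qᵀ * U * Z) = 1 ∧
    Qᵀ * A * Z = Qᵀ * V * Z - Matrix.vecMulVec (Qᵀ.mulVec z) (Zᵀ.mulVec w) ∧
    Qᵀ * B * Z = Qᵀ * U * Z - Matrix.vecMulVec (Qᵀ.mulVec p) (Zᵀ.mulVec q) := by
  subst hA hB
  exact ⟨Matrix.transpose_mul_self_conj_eq_one hQ hV hZ,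
    Matrix.transpose_mul_self_conj_eq_one hQ hU hZ,
    Matrix.mul_sub_vecMulVec_mul _ _ _ _ _, Matrix.mul_sub_vecMulVec_mul _ _ _ _ _⟩
end

section
/- Let N ≥ 1, let z_j = e^{2πi(j−1)/N}, j = 1,…,N, be the N-th roots of unity, and let f_1,…,f_N ∈ ℂ. The unique polynomial p of degree less than N with p(z_j) = f_j for j = 1,…,N satisfies, for every z ∈ ℂ with z^N ≠ 1, the barycentric formula p(z) = (z^N − 1) ∑_{j=1}^{N} (w_j f_j)/(z − z_j), where w_j = z_j / N. -/
open scoped BigOperators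

open Polynomial in
/-- The nodal polynomial of `N` distinct `N`-th roots of unity is `X ^ N - 1`. -/
theorem Lagrange.nodal_eq_X_pow_sub_one {F : Type*} [Field F] {N : ℕ} (hN : N ≠ 0)
    {z : Fin N → F} (hinj : Function.Injective z) (hpow : ∀ j, z j ^ N = 1) :
    Lagrange.nodal Finset.univ z = X ^ N - 1 := by
  have hdeg : (X ^ N - 1 : F[X]).degree = N := by
    simpa using degree_X_pow_sub_C (Nat.pos_of_ne_zero hN) (1 : F)
  have hmonic : (X ^ N - 1 : F[X]).Monic := by
    simpa using monic_X_pow_sub_C (1 : F) hN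
  have hnodal : (Lagrange.nodal Finset.univ z).degree = N := by
    simp [Lagrange.degree_nodal]
  refine eq_of_degree_sub_lt_of_eval_index_eq Finset.univ hinj.injOn ?_ fun j _ => ?_
  · have h := degree_sub_lt_left (hnodal.trans hdeg.symm) Lagrange.nodal_ne_zero
      (Lagrange.nodal_monic.leadingCoeff.trans hmonic.leadingCoeff.symm)
    simpa [hnodal] using h
  · rw [Lagrange.eval_nodal_at_node (Finset.mem_univ j)]
    simp [hpow]

/-- The barycentric weights at `N` distinct `N`-th roots of unity are `z j / N`. -/
theorem Lagrange.nodalWeight_eq_div_of_pow_eq_one {F : Type*} [Field F] {N : ℕ} (hN : N ≠ 0)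
    {z : Fin N → F} (hinj : Function.Injective z) (hpow : ∀ j, z j ^ N = 1) (j : Fin N) :
    Lagrange.nodalWeight Finset.univ z j = z j / N := by
  have hinv : (z j ^ (N - 1))⁻¹ = z j :=
    inv_eq_of_mul_eq_one_right (by rw [pow_sub_one_mul hN, hpow])
  rw [Lagrange.nodalWeight_eq_eval_derivative_nodal (Finset.mem_univ j),
    Lagrange.nodal_eq_X_pow_sub_one hN hinj hpow]
  simp [Polynomial.derivative_X_pow, hinv, div_eq_mul_inv]

/-- Barycentric formula for Lagrange interpolation at the `N`-th roots of
unity: if `p` has degree `< N` and `p(z_j) = f_j` at the nodes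
`z_j = e^{2πi(j-1)/N}`, then for every `z` with `z^N ≠ 1`,
`p(z) = (z^N - 1) ∑_j (w_j f_j)/(z - z_j)` with `w_j = z_j / N`. -/
theorem barycentric_lagrange_formula_at_roots_of_unity
    (N : ℕ) (hN : 1 ≤ N) (z : Fin N → ℂ)
    (hz : ∀ j : Fin N, z j = Complex.exp (2 * Real.pi * Complex.I * (j : ℕ) / N))
    (f : Fin N → ℂ) (p : Polynomial ℂ)
    (hdeg : p.degree < (N : ℕ))
    (hinterp : ∀ j : Fin N, p.eval (z j) = f j)
    (x : ℂ) (hx : x ^ N ≠ 1) :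
    p.eval x = (x ^ N - 1) * ∑ j : Fin N, (z j / N * f j) / (x - z j) := by
  have hN0 : N ≠ 0 := Nat.one_le_iff_ne_zero.mp hN
  have hprim := Complex.isPrimitiveRoot_exp N hN0
  have hzpow : ∀ j : Fin N, z j = Complex.exp (2 * Real.pi * Complex.I / N) ^ (j : ℕ) := by
    intro j
    rw [hz, ← Complex.exp_nat_mul]
    congr 1
    ring
  have hinj : Function.Injective z := fun i j hij =>
    Fin.ext (hprim.pow_inj i.isLt j.isLt (by rw [← hzpow, ← hzpow, hij]))
  have hpow : ∀ j, z j ^ N = 1 := fun j => by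
    rw [hzpow, pow_right_comm, hprim.pow_eq_one, one_pow]
  have hne : ∀ j ∈ Finset.univ, x ≠ z j := fun j _ h => hx (h ▸ hpow j)
  rw [Lagrange.eq_interpolate_of_eval_eq (s := Finset.univ) f hinj.injOn (by simpa using hdeg)
      (fun j _ => hinterp j), Lagrange.eval_interpolate_not_at_node f hne,
    Lagrange.nodal_eq_X_pow_sub_one hN0 hinj hpow]
  simp only [Polynomial.eval_sub, Polynomial.eval_pow, Polynomial.eval_X, Polynomial.eval_one]
  congr 1
  refine Finset.sum_congr rfl fun j _ => ?_
  rw [Lagrange.nodalWeight_eq_div_of_pow_eq_one hN0 hinj hpow]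
  ring
end

section
/- With F and G the (N+1)×(N+1) matrices defined by F(1,1) = 0, F(1, j+1) = −f_j/ξ_j, F(j+1, 1) = w_j ξ_j, F(j+1, j+1) = z_j (all other entries zero), and G = diag(0, 1, …, 1), the function λ ↦ det(F − λG) is a polynomial in λ of degree at most N − 1. In particular, the degree of det(F − λG) is at least two less than the size N+1 of the pencil. -/
open scoped BigOperators

/-- If a matrix of polynomials of degree at most one has constant entries in the row and the column
through a zero diagonal entry, then the degree of its determinant is at least two less than its
size. -/
theorem Matrix.natDegree_det_le_card_sub_two {n R : Type*} [Fintype n] [DecidableEq n]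
    [CommRing R] (A : Matrix n n (Polynomial R)) (i₀ : n) (h₀ : A i₀ i₀ = 0)
    (hrow : ∀ j, (A i₀ j).natDegree = 0) (hcol : ∀ i, (A i i₀).natDegree = 0)
    (hdeg : ∀ i j, (A i j).natDegree ≤ 1) :
    A.det.natDegree ≤ Fintype.card n - 2 := by
  rw [Matrix.det_apply]
  refine Polynomial.natDegree_sum_le_of_forall_le _ _ fun σ _ => ?_
  refine (Polynomial.natDegree_smul_le _ _).trans ?_
  by_cases hσ : σ i₀ = i₀
  · rw [Finset.prod_eq_zero (Finset.mem_univ i₀) (by rw [hσ, h₀])]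
    simp
  have hne : i₀ ≠ σ.symm i₀ := fun h => hσ (by rw [h, Equiv.apply_symm_apply, ← h])
  calc (∏ i, A (σ i) i).natDegree
      ≤ ∑ i, (A (σ i) i).natDegree := Polynomial.natDegree_prod_le _ _
    _ = ∑ i ∈ Finset.univ \ {i₀, σ.symm i₀}, (A (σ i) i).natDegree := by
        refine (Finset.sum_subset (Finset.subset_univ _) fun i _ hi => ?_).symm
        obtain rfl | rfl : i = i₀ ∨ i = σ.symm i₀ := by
          simpa [or_iff_not_imp_left] using hi
        · exact hcol _
        · rw [Equiv.apply_symm_apply]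
          exact hrow _
    _ ≤ (Finset.univ \ {i₀, σ.symm i₀}).card := by
        simpa using Finset.sum_le_card_nsmul _ _ 1 fun i _ => hdeg (σ i) i
    _ = Fintype.card n - 2 := by
        rw [Finset.card_sdiff_of_subset (Finset.subset_univ _), Finset.card_pair hne,
          Finset.card_univ]

/-- The function `λ ↦ det(F - λG)` for the arrowhead Lagrange pencil is a
polynomial of degree at most `N - 1`; in particular its degree is at least two
less than the size `N + 1` of the pencil (the pencil has at least two infinite
eigenvalues). -/
theorem det_arrowhead_lagrange_pencil_degree_le
    (N : ℕ) (hN : 1 ≤ N)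
    (z f w ξ : Fin N → ℂ)
    (hz : Function.Injective z)
    (hξ : ∀ j, ξ j ≠ 0)
    (F G : Matrix (Fin (N + 1)) (Fin (N + 1)) ℂ)
    (hF00 : F 0 0 = 0)
    (hFrow : ∀ j : Fin N, F 0 j.succ = -(f j / ξ j))
    (hFcol : ∀ j : Fin N, F j.succ 0 = w j * ξ j)
    (hFdiag : ∀ j : Fin N, F j.succ j.succ = z j)
    (hFzero : ∀ j k : Fin N, j ≠ k → F j.succ k.succ = 0)
    (hG00 : G 0 0 = 0)
    (hGdiag : ∀ j : Fin N, G j.succ j.succ = 1)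
    (hGzero : ∀ i j : Fin (N + 1), i ≠ j → G i j = 0) :
    ∃ P : Polynomial ℂ, P.degree ≤ (N - 1 : ℕ) ∧
      ∀ lam : ℂ, (F - lam • G).det = P.eval lam := by
  let A : Matrix (Fin (N + 1)) (Fin (N + 1)) (Polynomial ℂ) :=
    Matrix.of fun i j => Polynomial.C (F i j) - Polynomial.X * Polynomial.C (G i j)
  have hG0 : ∀ i j, i = 0 ∨ j = 0 → G i j = 0 := by
    intro i j h
    by_cases hij : i = j
    · subst hij
      obtain rfl : i = 0 := by simpa using h
      exact hG00
    · exact hGzero i j hij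
  refine ⟨A.det, ?_, fun lam => ?_⟩
  · have hA : A.det.natDegree ≤ Fintype.card (Fin (N + 1)) - 2 := by
      refine A.natDegree_det_le_card_sub_two 0 ?_ (fun j => ?_) (fun i => ?_) fun i j => ?_
      · simp [A, hF00, hG00]
      · simp [A, hG0 0 j (Or.inl rfl)]
      · simp [A, hG0 i 0 (Or.inr rfl)]
      · simp only [A, Matrix.of_apply]
        compute_degree
    refine Polynomial.degree_le_of_natDegree_le (hA.trans ?_)
    simp
  · rw [← Polynomial.coe_evalRingHom, RingHom.map_det]
    congr 1
    ext i j
    simp [A]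
    ring
end

section
/- Let M be a real N×N matrix and r ≥ 1 an integer such that for every k with 1 ≤ k ≤ N−1 the submatrix M(1:k, k+1:N) has rank at most r. Then M admits upper quasiseparable generators of order r: there exist row vectors g(1),…,g(N−1) ∈ ℝ^{1×r}, column vectors h(2),…,h(N) ∈ ℝ^{r×1}, and matrices b(2),…,b(N−1) ∈ ℝ^{r×r} such that for all 1 ≤ i < j ≤ N one has M(i,j) = g(i) b(i+1) b(i+2) ⋯ b(j−1) h(j), where the empty product (case j = i+1) is interpreted as the r×r identity matrix. -/
open scoped Matrix

/-- The block `M(1:k, k+1:N)`, padded with zeros to the size of `M`. -/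
def Matrix.upperBlock {N : ℕ} {R : Type*} [Zero R] (M : Matrix (Fin N) (Fin N) R) (k : ℕ) :
    Matrix (Fin N) (Fin N) R :=
  .of fun i j => if (i : ℕ) < k ∧ k ≤ (j : ℕ) then M i j else 0

/-- A matrix of rank at most `r` factors through its column space. -/
theorem Matrix.exists_eq_mul_mul_self_of_rank_le {m n K : Type*} [Fintype m] [Fintype n]
    [Field K] (A : Matrix m n K) {r : ℕ} (hA : A.rank ≤ r) :
    ∃ (G : Matrix m (Fin r) K) (C : Matrix (Fin r) m K), A = G * (C * A) := by
  classical
  let W := LinearMap.range A.mulVecLin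
  obtain ⟨φ, hφ⟩ : ∃ φ : W →ₗ[K] (Fin r → K), Function.Injective φ :=
    finrank_le_iff_exists_linearMap.1 (by simpa [W, Matrix.rank] using hA)
  obtain ⟨ψ, hψ⟩ := φ.exists_leftInverse_of_injective (LinearMap.ker_eq_bot.2 hφ)
  obtain ⟨χ, hχ⟩ := φ.exists_extend
  refine ⟨(W.subtype ∘ₗ ψ).toMatrix', χ.toMatrix', ?_⟩
  refine Matrix.mulVec_injective (funext fun v => ?_)
  have h₁ : χ (A *ᵥ v) = φ ⟨A *ᵥ v, v, rfl⟩ := congr($hχ ⟨A *ᵥ v, v, rfl⟩)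
  have h₂ : ψ (φ ⟨A *ᵥ v, v, rfl⟩) = ⟨A *ᵥ v, v, rfl⟩ := congr($hψ ⟨A *ᵥ v, v, rfl⟩)
  simp [← Matrix.mulVec_mulVec, LinearMap.toMatrix'_mulVec, h₁, h₂]

theorem Matrix.rank_upperBlock_le {N : ℕ} {K : Type*} [Field K] (M : Matrix (Fin N) (Fin N) K)
    {k : ℕ} (hk : k ≤ N) :
    (M.upperBlock k).rank ≤ (M.submatrix (Fin.castLE hk)
      (fun j : Fin (N - k) => (⟨k + (j : ℕ), by have := j.isLt; omega⟩ : Fin N))).rank := by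
  set S := M.submatrix (Fin.castLE hk)
      (fun j : Fin (N - k) => (⟨k + (j : ℕ), by have := j.isLt; omega⟩ : Fin N)) with hS
  let P : Matrix (Fin N) (Fin k) K := .of fun i a => if (i : ℕ) = a then 1 else 0
  let Q : Matrix (Fin (N - k)) (Fin N) K := .of fun b j => if (j : ℕ) = k + b then 1 else 0
  suffices h : M.upperBlock k = P * S * Q by
    rw [h]
    exact (Matrix.rank_mul_le_left _ _).trans (Matrix.rank_mul_le_right _ _)
  have hP : ∀ i b, (P * S) i b = if h : (i : ℕ) < k then S ⟨i, h⟩ b else 0 := by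
    intro i b
    simp only [Matrix.mul_apply, P, Matrix.of_apply, ite_mul, one_mul, zero_mul]
    split_ifs with h
    · rw [Finset.sum_eq_single ⟨i, h⟩] <;> simp +contextual [Fin.ext_iff, eq_comm]
    · exact Finset.sum_eq_zero fun a _ => if_neg (by omega)
  ext i j
  simp only [Matrix.mul_apply (M := P * S), hP, Q, Matrix.of_apply, mul_ite, mul_one, mul_zero,
    Matrix.upperBlock]
  by_cases hj : k ≤ (j : ℕ)
  · rw [Finset.sum_eq_single ⟨j - k, by omega⟩]
    · by_cases hi : (i : ℕ) < k <;> simp [hi, hj, hS]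
    · intro b _ hb
      exact if_neg fun h => hb (Fin.ext (by simp; omega))
    · simp
  · rw [if_neg (by tauto), Finset.sum_eq_zero]
    exact fun b _ => if_neg (by omega)

theorem Matrix.upperBlock_apply {N : ℕ} {R : Type*} [Zero R] (M : Matrix (Fin N) (Fin N) R)
    {k : ℕ} {i j : Fin N} (hi : (i : ℕ) < k) (hj : k ≤ (j : ℕ)) :
    M.upperBlock k i j = M i j :=
  if_pos ⟨hi, hj⟩

/-- Away from its first column, `M(1:k, k+1:N)` is `M(1:k+1, k+2:N)` without the last row. -/
theorem Matrix.diagonal_mul_upperBlock_succ_apply {N : ℕ} {R : Type*} [NonAssocSemiring R]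
    (M : Matrix (Fin N) (Fin N) R) {k : ℕ} (i : Fin N) {j : Fin N} (hj : k < (j : ℕ)) :
    (Matrix.diagonal (fun a : Fin N => if (a : ℕ) < k then (1 : R) else 0) *
      M.upperBlock (k + 1)) i j = M.upperBlock k i j := by
  by_cases hi : (i : ℕ) < k
  · simp [Matrix.diagonal_mul, hi, M.upperBlock_apply hi hj.le,
      M.upperBlock_apply (Nat.lt_succ_of_lt hi) (Nat.succ_le_of_lt hj)]
  · simp [Matrix.diagonal_mul, Matrix.upperBlock, hi]

theorem Matrix.mul_apply_congr_right {l m n R : Type*} [Fintype m] [NonUnitalNonAssocSemiring R]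
    (A : Matrix l m R) {B B' : Matrix m n R} {j : n} (h : ∀ a, B a j = B' a j) (i : l) :
    (A * B) i j = (A * B') i j := by
  simp only [Matrix.mul_apply, h]

/-- Existence of upper quasiseparable generators of order `r` for a matrix
whose upper off-diagonal blocks `M(1:k, k+1:N)` all have rank at most `r`:
there are generators `g(i)` (`1×r` rows), `h(j)` (`r×1` columns) and `b(k)`
(`r×r` matrices) with `M(i,j) = g(i) b(i+1) ⋯ b(j-1) h(j)` for `i < j`
(the empty product being the identity). -/
theorem exists_upper_quasiseparable_generators
    (N r : ℕ) (hr : 1 ≤ r) (M : Matrix (Fin N) (Fin N) ℝ)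
    (hrank : ∀ k : ℕ, ∀ hk1 : 1 ≤ k, ∀ hk2 : k ≤ N - 1,
      (M.submatrix (fun i : Fin k => Fin.castLE (by omega) i)
        (fun j : Fin (N - k) =>
          (⟨k + (j : ℕ), by have := j.isLt; omega⟩ : Fin N))).rank ≤ r) :
    ∃ (g : ℕ → Matrix (Fin 1) (Fin r) ℝ) (h : ℕ → Matrix (Fin r) (Fin 1) ℝ)
      (b : ℕ → Matrix (Fin r) (Fin r) ℝ),
      ∀ i j : Fin N, i < j →
        M i j =
          (g (i : ℕ) *
            ((List.range' ((i : ℕ) + 1) ((j : ℕ) - (i : ℕ) - 1)).map b).prod *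
            h (j : ℕ)) 0 0 := by
  have hrank' : ∀ k, (M.upperBlock k).rank ≤ r := by
    intro k
    by_cases hk : 1 ≤ k ∧ k ≤ N - 1
    · exact (M.rank_upperBlock_le (by omega)).trans (hrank k hk.1 hk.2)
    · have h₀ : M.upperBlock k = 0 := by
        ext i j
        exact if_neg (by omega)
      simp [h₀]
  choose G C hGC using fun k => (M.upperBlock k).exists_eq_mul_mul_self_of_rank_le (hrank' k)
  let D (k : ℕ) : Matrix (Fin N) (Fin N) ℝ :=
    Matrix.diagonal fun a => if (a : ℕ) < k then 1 else 0
  let g (i : ℕ) : Matrix (Fin 1) (Fin r) ℝ :=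
    .of fun _ a => if hi : i < N then G (i + 1) ⟨i, hi⟩ a else 0
  let h (j : ℕ) : Matrix (Fin r) (Fin 1) ℝ :=
    .of fun a _ => if hj : j < N then (C j * M.upperBlock j) a ⟨j, hj⟩ else 0
  let b (k : ℕ) : Matrix (Fin r) (Fin r) ℝ := C k * D k * G (k + 1)
  have key : ∀ (i : Fin N) (d : ℕ) (j : Fin N), (i : ℕ) + 1 + d ≤ j →
      M i j = (g i * ((List.range' ((i : ℕ) + 1) d).map b).prod *
        (C (i + 1 + d) * M.upperBlock (i + 1 + d))) 0 j := by
    intro i d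
    induction d with
    | zero =>
      intro j hj
      calc
        M i j = M.upperBlock (i + 1) i j := (M.upperBlock_apply (Nat.lt_succ_self i) hj).symm
        _ = (G (i + 1) * (C (i + 1) * M.upperBlock (i + 1))) i j := by rw [← hGC]
        _ = _ := by
          simp [g, Matrix.mul_apply (M := G _), Matrix.mul_apply (M := Matrix.of _)]
    | succ d ih =>
      intro j hj
      set k := (i : ℕ) + 1 + d with hk
      set w := g i * ((List.range' ((i : ℕ) + 1) d).map b).prod with hw
      calc
        M i j = (w * C k * M.upperBlock k) 0 j := by rw [ih j (by omega), Matrix.mul_assoc w]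
        _ = (w * C k * (D k * M.upperBlock (k + 1))) 0 j :=
          Matrix.mul_apply_congr_right _
            (fun a => (M.diagonal_mul_upperBlock_succ_apply a (by omega)).symm) _
        _ = (w * C k * (D k * (G (k + 1) * (C (k + 1) * M.upperBlock (k + 1))))) 0 j := by
          rw [← hGC]
        _ = _ := by
          simp only [List.range'_concat, List.map_append, List.map_cons, List.map_nil,
            List.prod_append, List.prod_singleton, one_mul, hw, b, Matrix.mul_assoc, ← hk,
            ← add_assoc]
  refine ⟨g, h, b, fun i j hij => ?_⟩
  have hd : (i : ℕ) + 1 + (j - i - 1) = j := by omega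
  rw [key i (j - i - 1) j hd.le, hd, Matrix.mul_apply, Matrix.mul_apply]
  simp [h]
end

section
/- Let N ≥ 1 and let V belong to the class 𝒱_N, i.e. V is a real orthogonal N×N matrix and there exist vectors z, w ∈ ℝᴺ such that V − z wᵀ is upper Hessenberg. Then V admits upper triangular generators of order at most 2: there exist row vectors g(1),…,g(N) ∈ ℝ^{1×2}, column vectors h(1),…,h(N) ∈ ℝ^{2×1}, and matrices b(1),…,b(N−1) ∈ ℝ^{2×2} such that for all 1 ≤ i ≤ j ≤ N one has V(i,j) = g(i) b(i) b(i+1) ⋯ b(j−1) h(j), where the empty product (case i = j) is interpreted as the 2×2 identity matrix. -/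
open scoped Matrix

/-- The block of `V` with rows `≤ k` and columns `≥ k`, padded with zeros. -/
def upperRightBlock {N : ℕ} (V : Matrix (Fin N) (Fin N) ℝ) (k : ℕ) :
    Matrix (Fin N) (Fin N) ℝ :=
  fun i j => if (i : ℕ) ≤ k ∧ k ≤ (j : ℕ) then V i j else 0

/-- Every subspace of dimension at most two is spanned by a pair of vectors. -/
lemma Submodule.exists_span_pair_of_finrank_le_two {E : Type*} [AddCommGroup E] [Module ℝ E]
    [FiniteDimensional ℝ E] (C : Submodule ℝ E) (hC : Module.finrank ℝ C ≤ 2) :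
    ∃ p : Fin 2 → E, Submodule.span ℝ (Set.range p) = C := by
  let B := Module.finBasis ℝ C
  refine ⟨fun a => if h : (a : ℕ) < Module.finrank ℝ C then (B ⟨a, h⟩ : E) else 0,
    le_antisymm ?_ ?_⟩
  · rw [Submodule.span_le]
    rintro _ ⟨a, rfl⟩
    dsimp only
    split_ifs with h
    · exact (B ⟨a, h⟩).2
    · exact C.zero_mem
  · intro x hx
    have hsum := congrArg Subtype.val (B.sum_repr ⟨x, hx⟩)
    simp only [Submodule.coe_sum, Submodule.coe_smul] at hsum
    rw [← hsum]
    refine Submodule.sum_mem _ fun i _ => Submodule.smul_mem _ _ (Submodule.subset_span ?_)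
    exact ⟨⟨i, i.2.trans_le hC⟩, by simp⟩

/-- The nullity theorem for the blocks of an orthogonal matrix that is a rank-one perturbation
of an upper Hessenberg matrix. -/
lemma finrank_range_upperRightBlock_le_two {N : ℕ} {V : Matrix (Fin N) (Fin N) ℝ}
    (hV : Vᵀ * V = 1) {z w : Fin N → ℝ}
    (hzw : ∀ i j : Fin N, (j : ℕ) + 1 < (i : ℕ) → V i j = z i * w j) (k : ℕ) :
    Module.finrank ℝ (LinearMap.range (upperRightBlock V k).mulVecLin) ≤ 2 := by
  by_cases hk : k < N
  swap
  · have h0 : upperRightBlock V k = 0 := by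
      ext i j
      have := j.2
      simp only [upperRightBlock, Matrix.zero_apply, ite_eq_right_iff]
      omega
    rw [h0, Matrix.mulVecLin_zero, LinearMap.range_zero, finrank_bot]
    exact Nat.zero_le 2
  have hV' : V * Vᵀ = 1 := mul_eq_one_comm.mp hV
  let lower : Matrix (Fin N) (Fin N) ℝ := Matrix.diagonal fun i => if k < (i : ℕ) then 1 else 0
  let upper : Matrix (Fin N) (Fin N) ℝ := Matrix.diagonal fun i => if (i : ℕ) < k then 1 else 0
  let Φ := (upper + Vᵀ * lower).mulVecLin
  let ℓ : (Fin N → ℝ) →ₗ[ℝ] (Fin 2 → ℝ) :=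
    (Matrix.of ![Pi.single ⟨k, hk⟩ 1, fun i : Fin N => if k < (i : ℕ) then z i else 0]).mulVecLin
  have hℓ : ∀ u ∈ LinearMap.ker ℓ, u ⟨k, hk⟩ = 0 ∧
      ∑ i : Fin N, (if k < (i : ℕ) then z i else 0) * u i = 0 := by
    intro u hu
    have h0 := congrFun (LinearMap.mem_ker.mp hu) 0
    have h1 := congrFun (LinearMap.mem_ker.mp hu) 1
    simp [ℓ, Matrix.mulVec] at h0
    simp only [ℓ, Matrix.mulVecLin_apply, Matrix.mulVec, dotProduct, Matrix.of_apply,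
      Matrix.cons_val_one, Pi.zero_apply] at h1
    exact ⟨h0, h1⟩
  have hlow : ∀ u : Fin N → ℝ, ∀ i, (lower *ᵥ u) i = if k < (i : ℕ) then u i else 0 := by
    intro u i
    simp [lower, Matrix.mulVec_diagonal]
  have hup : ∀ u : Fin N → ℝ, ∀ i, (upper *ᵥ u) i = if (i : ℕ) < k then u i else 0 := by
    intro u i
    simp [upper, Matrix.mulVec_diagonal]
  have hΦ : ∀ u, Φ u = upper *ᵥ u + Vᵀ *ᵥ (lower *ᵥ u) := by
    intro u
    rw [Matrix.mulVec_mulVec, ← Matrix.add_mulVec]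
    rfl
  have hsupp : ∀ u ∈ LinearMap.ker ℓ, ∀ j : Fin N, (j : ℕ) < k →
      (Vᵀ *ᵥ (lower *ᵥ u)) j = 0 := by
    intro u hu j hj
    have hsum := (hℓ u hu).2
    calc (Vᵀ *ᵥ (lower *ᵥ u)) j
        = ∑ i : Fin N, w j * ((if k < (i : ℕ) then z i else 0) * u i) := by
          simp only [Matrix.mulVec, dotProduct, Matrix.transpose_apply]
          refine Finset.sum_congr rfl fun i _ => ?_
          have := hlow u i
          simp only [Matrix.mulVec, dotProduct] at this
          rw [this]
          split_ifs with h
          · rw [hzw i j (by omega)]; ring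
          · simp
      _ = 0 := by rw [← Finset.mul_sum, hsum, mul_zero]
  have hinj : Function.Injective (Φ.domRestrict (LinearMap.ker ℓ)) := by
    rw [injective_iff_map_eq_zero]
    rintro ⟨u, hu⟩ h
    replace h : Φ u = 0 := h
    rw [hΦ] at h
    have hlt : ∀ i : Fin N, (i : ℕ) < k → u i = 0 := by
      intro i hi
      have := congrFun h i
      rwa [Pi.add_apply, hsupp u hu i hi, hup, if_pos hi, add_zero] at this
    have hup0 : upper *ᵥ u = 0 := by
      ext i
      rw [hup]
      split_ifs with hi
      · exact hlt i hi
      · rfl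
    rw [hup0, zero_add] at h
    have hlow0 : lower *ᵥ u = 0 := by
      have := congrArg (V *ᵥ ·) h
      simpa only [Matrix.mulVec_mulVec, ← Matrix.mul_assoc, hV', Matrix.one_mul,
        Matrix.mulVec_zero] using this
    refine Subtype.ext (funext fun i => ?_)
    rcases lt_trichotomy (i : ℕ) k with hi | hi | hi
    · exact hlt i hi
    · have : i = ⟨k, hk⟩ := Fin.ext hi
      rw [this]
      exact (hℓ u hu).1
    · have := congrFun hlow0 i
      rwa [hlow, if_pos hi] at this
  have hker : LinearMap.range (Φ.domRestrict (LinearMap.ker ℓ)) ≤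
      LinearMap.ker (upperRightBlock V k).mulVecLin := by
    rintro _ ⟨⟨u, hu⟩, rfl⟩
    rw [LinearMap.mem_ker]
    change upperRightBlock V k *ᵥ (Φ u) = 0
    rw [hΦ]
    ext i
    by_cases hi : (i : ℕ) ≤ k
    · have h1 : (upperRightBlock V k *ᵥ (upper *ᵥ u + Vᵀ *ᵥ (lower *ᵥ u))) i =
          (V *ᵥ (Vᵀ *ᵥ (lower *ᵥ u))) i := by
        change ∑ j, upperRightBlock V k i j * (upper *ᵥ u + Vᵀ *ᵥ (lower *ᵥ u)) j =
          ∑ j, V i j * (Vᵀ *ᵥ (lower *ᵥ u)) j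
        refine Finset.sum_congr rfl fun j _ => ?_
        rw [Pi.add_apply, hup]
        by_cases hj : (j : ℕ) < k
        · rw [hsupp u hu j hj]
          simp [upperRightBlock, hj]
        · simp [upperRightBlock, hi, hj, not_lt.mp hj]
      rw [h1, Matrix.mulVec_mulVec, hV', Matrix.one_mulVec, hlow, if_neg (by omega)]
      rfl
    · change ∑ j, upperRightBlock V k i j * (upper *ᵥ u + Vᵀ *ᵥ (lower *ᵥ u)) j = 0
      refine Finset.sum_eq_zero fun j _ => ?_
      simp [upperRightBlock, hi]
  have e1 := LinearMap.finrank_range_add_finrank_ker (upperRightBlock V k).mulVecLin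
  have e2 := LinearMap.finrank_range_add_finrank_ker ℓ
  have e3 := Submodule.finrank_mono hker
  rw [LinearMap.finrank_range_of_inj hinj] at e3
  have e4 := Submodule.finrank_le (LinearMap.range ℓ)
  simp only [Module.finrank_fintype_fun_eq_card, Fintype.card_fin] at e1 e2 e4
  omega

/-- Any `V ∈ 𝒱_N` (orthogonal with `V - z wᵀ` upper Hessenberg for some
vectors `z, w`) admits upper triangular generators of order at most 2:
`V(i,j) = g(i) b(i) b(i+1) ⋯ b(j-1) h(j)` for all `i ≤ j`, with `g(i)` `1×2`
rows, `h(j)` `2×1` columns and `b(k)` `2×2` matrices (the empty product being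
the identity). -/
theorem class_V_has_upper_triangular_generators_order_two
    (N : ℕ) (hN : 1 ≤ N) (V : Matrix (Fin N) (Fin N) ℝ)
    (hV : Vᵀ * V = 1)
    (hVclass : ∃ z w : Fin N → ℝ,
      ∀ i j : Fin N, (j : ℕ) + 1 < (i : ℕ) → (V - Matrix.vecMulVec z w) i j = 0) :
    ∃ (g : ℕ → Matrix (Fin 1) (Fin 2) ℝ) (h : ℕ → Matrix (Fin 2) (Fin 1) ℝ)
      (b : ℕ → Matrix (Fin 2) (Fin 2) ℝ),
      ∀ i j : Fin N, i ≤ j →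
        V i j =
          (g (i : ℕ) *
            ((List.range' (i : ℕ) ((j : ℕ) - (i : ℕ))).map b).prod *
            h (j : ℕ)) 0 0 := by
  obtain ⟨z, w, hzw⟩ := hVclass
  replace hzw : ∀ i j : Fin N, (j : ℕ) + 1 < (i : ℕ) → V i j = z i * w j := fun i j hij =>
    sub_eq_zero.mp (hzw i j hij)
  choose p hp using fun k => Submodule.exists_span_pair_of_finrank_le_two _
    (finrank_range_upperRightBlock_le_two hV hzw k)
  have hmem : ∀ k x, x ∈ LinearMap.range (upperRightBlock V k).mulVecLin →
      ∃ c : Fin 2 → ℝ, ∑ a, c a • p k a = x := fun k x hx =>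
    (Submodule.mem_span_range_iff_exists_fun ℝ).mp (hp k ▸ hx)
  have hcol : ∀ k, ∃ c : Fin 2 → ℝ, ∀ i j : Fin N, (j : ℕ) = k → i ≤ j →
      V i j = ∑ a, p k a i * c a := by
    intro k
    by_cases hk : k < N
    · obtain ⟨c, hc⟩ := hmem k _ ⟨Pi.single ⟨k, hk⟩ 1, rfl⟩
      refine ⟨c, ?_⟩
      rintro i j rfl hij
      have := congrFun hc i
      simp only [Finset.sum_apply, Pi.smul_apply, smul_eq_mul, Matrix.mulVecLin_apply,
        Matrix.mulVec_single_one, Matrix.col_apply, upperRightBlock] at this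
      rw [if_pos ⟨hij, le_rfl⟩] at this
      rw [← this]
      exact Finset.sum_congr rfl fun a _ => mul_comm _ _
    · exact ⟨0, fun i j hj => absurd (hj ▸ j.2) hk⟩
  have hstep : ∀ k (a : Fin 2), ∃ c : Fin 2 → ℝ, ∀ i : Fin N, (i : ℕ) ≤ k →
      p (k + 1) a i = ∑ d, p k d i * c d := by
    intro k a
    have ha : p (k + 1) a ∈ LinearMap.range (upperRightBlock V (k + 1)).mulVecLin :=
      hp (k + 1) ▸ Submodule.subset_span ⟨a, rfl⟩
    obtain ⟨u, hu⟩ := ha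
    obtain ⟨c, hc⟩ := hmem k _ ⟨fun j => if k + 1 ≤ (j : ℕ) then u j else 0, rfl⟩
    refine ⟨c, fun i hi => ?_⟩
    have h1 := congrFun hc i
    simp only [Finset.sum_apply, Pi.smul_apply, smul_eq_mul] at h1
    rw [Finset.sum_congr rfl fun d _ => mul_comm (p k d i) (c d), h1, ← hu]
    change ∑ j, upperRightBlock V (k + 1) i j * u j =
      ∑ j, upperRightBlock V k i j * (if k + 1 ≤ (j : ℕ) then u j else 0)
    refine Finset.sum_congr rfl fun j _ => ?_
    by_cases hj : k + 1 ≤ (j : ℕ)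
    · simp [upperRightBlock, hj, hi, show (i : ℕ) ≤ k + 1 by omega, show k ≤ (j : ℕ) by omega]
    · simp [upperRightBlock, hj]
  choose c hc using hcol
  choose β hβ using hstep
  let P : ℕ → Fin N → Matrix (Fin 1) (Fin 2) ℝ := fun k i => Matrix.of fun _ a => p k a i
  let b : ℕ → Matrix (Fin 2) (Fin 2) ℝ := fun k => Matrix.of fun d a => β k a d
  have hP : ∀ (i : Fin N) (n : ℕ),
      P (i + n) i = P i i * ((List.range' (i : ℕ) n).map b).prod := by
    intro i n
    induction n with
    | zero => simp
    | succ n ih =>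
      rw [List.range'_concat, List.map_append, List.prod_append, ← Matrix.mul_assoc, ← ih]
      ext _ a
      simpa [P, b, Matrix.mul_apply, add_assoc] using hβ (i + n) a i (by omega)
  refine ⟨fun k => if hk : k < N then P k ⟨k, hk⟩ else 0,
    fun k => Matrix.of fun a _ => c k a, b, fun i j hij => ?_⟩
  have hPij := hP i (j - i)
  rw [Nat.add_sub_cancel' (show (i : ℕ) ≤ j from hij)] at hPij
  simp only [i.2, dif_pos, Fin.eta]
  rw [← hPij, hc j i j rfl hij]
  simp [P, Matrix.mul_apply]
end

section
/- Let N ≥ 2 and let U belong to the class 𝒰_N, i.e. U is a real orthogonal N×N matrix and there exist vectors p, q ∈ ℝᴺ such that U − p qᵀ is upper triangular. Then U admits upper quasiseparable generators of order one: there exist real numbers g(1),…,g(N−1), h(2),…,h(N), and b(2),…,b(N−1) such that for all 1 ≤ i < j ≤ N one has U(i,j) = g(i) b(i+1) b(i+2) ⋯ b(j−1) h(j), where the empty product (case j = i+1) is interpreted as 1. -/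
open scoped Matrix BigOperators

/-- **Nullity theorem** for orthogonal matrices, in the rank one case: if the block of rows outside
`S` and columns in `S` is `p qᵀ`, then all `2 × 2` minors of the complementary block vanish. -/
theorem Matrix.mul_eq_mul_of_orthogonal_of_compl_block {n : Type*} [Fintype n] [DecidableEq n]
    (U : Matrix n n ℝ) (hU : Uᵀ * U = 1) (S : Set n) (p q : n → ℝ)
    (hpq : ∀ i ∉ S, ∀ j ∈ S, U i j = p i * q j)
    {i i' j j' : n} (hi : i ∈ S) (hi' : i' ∈ S) (hj : j ∉ S) (hj' : j' ∉ S) :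
    U i j * U i' j' = U i j' * U i' j := by
  classical
  have hinner (x y : n → ℝ) : (U *ᵥ x) ⬝ᵥ (U *ᵥ y) = x ⬝ᵥ y := by
    rw [Matrix.dotProduct_mulVec, Matrix.vecMul_mulVec, ← Matrix.dotProduct_mulVec,
      hU, Matrix.one_mulVec]
  let ext : (S → ℝ) →ₗ[ℝ] (n → ℝ) :=
    { toFun := fun x a => if h : a ∈ S then x ⟨a, h⟩ else 0
      map_add' := fun x y => by ext a; by_cases h : a ∈ S <;> simp [h]
      map_smul' := fun c x => by ext a; by_cases h : a ∈ S <;> simp [h] }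
  have ext_notMem (x : S → ℝ) {a : n} (h : a ∉ S) : ext x a = 0 := dif_neg h
  have ext_coe (x : S → ℝ) (a : S) : ext x a = x a := dif_pos a.2
  let T : ((S → ℝ) × (ℝ × ℝ)) →ₗ[ℝ] ((S → ℝ) × ℝ) :=
    { toFun := fun z => (fun a => (U *ᵥ ext z.1) a + (z.2.1 * U a j + z.2.2 * U a j'),
        q ⬝ᵥ ext z.1)
      map_add' := fun x y => by
        ext
        · simp [Matrix.mulVec_add]; ring
        · simp [dotProduct_add]
      map_smul' := fun c x => by
        ext
        · simp [Matrix.mulVec_smul]; ring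
        · simp [dotProduct_smul] }
  have hker : LinearMap.ker T ≠ ⊥ := LinearMap.ker_ne_bot_of_finrank_lt (by simp)
  obtain ⟨⟨x, s, t⟩, hz, hne⟩ := Submodule.exists_mem_ne_zero_of_ne_bot hker
  rw [LinearMap.mem_ker] at hz
  have hS (a : n) (ha : a ∈ S) : (U *ᵥ ext x) a = -(s * U a j + t * U a j') := by
    have := congrFun (congrArg Prod.fst hz) ⟨a, ha⟩
    exact eq_neg_of_add_eq_zero_left this
  have hq : q ⬝ᵥ ext x = 0 := congrArg Prod.snd hz
  have hSc (a : n) (ha : a ∉ S) : (U *ᵥ ext x) a = 0 := by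
    have : (U *ᵥ ext x) a = p a * (q ⬝ᵥ ext x) := by
      simp only [Matrix.mulVec, dotProduct, Finset.mul_sum]
      refine Finset.sum_congr rfl fun b _ => ?_
      by_cases hb : b ∈ S
      · rw [hpq a ha b hb, mul_assoc]
      · simp [ext_notMem x hb]
    rw [this, hq, mul_zero]
  let y : n → ℝ := Pi.single j s + Pi.single j' t
  have hUy (a : n) : (U *ᵥ y) a = s * U a j + t * U a j' := by
    simp [y, Matrix.mulVec_add]
  have horth : (U *ᵥ ext x) ⬝ᵥ (U *ᵥ y) = 0 := by
    rw [hinner]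
    simp [y, dotProduct_add, ext_notMem x hj, ext_notMem x hj']
  have hself : (U *ᵥ ext x) ⬝ᵥ (U *ᵥ ext x) = -((U *ᵥ ext x) ⬝ᵥ (U *ᵥ y)) := by
    simp only [dotProduct, ← Finset.sum_neg_distrib]
    refine Finset.sum_congr rfl fun a _ => ?_
    by_cases ha : a ∈ S
    · rw [hUy, hS a ha]; ring
    · simp [hSc a ha]
  rw [horth, neg_zero] at hself
  have hUx : U *ᵥ ext x = 0 := dotProduct_self_eq_zero.mp hself
  have hx : x = 0 := by
    rw [hinner, dotProduct_self_eq_zero] at hself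
    ext a
    rw [← ext_coe x a, hself]
    rfl
  have hcol (a : n) (ha : a ∈ S) : s * U a j + t * U a j' = 0 := by
    have := hS a ha
    rw [hUx, Pi.zero_apply] at this
    linarith
  have h₁ := hcol i hi
  have h₂ := hcol i' hi'
  have hst : s ≠ 0 ∨ t ≠ 0 := by
    by_contra! h
    exact hne (by simp [hx, h.1, h.2])
  rcases hst with hs | ht
  · refine mul_left_cancel₀ hs ?_
    linear_combination U i' j' * h₁ - U i j' * h₂
  · refine mul_left_cancel₀ ht ?_
    linear_combination U i j * h₂ - U i' j * h₁

/-- An array whose `2 × 2` minors contained in its strictly upper triangular part all vanish admits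
upper quasiseparable generators of order one. -/
theorem exists_quasiseparable_generators_of_minors_eq_zero {K : Type*} [Field K] (a : ℕ → ℕ → K)
    (ha : ∀ k i i' j j', i ≤ k → i' ≤ k → k < j → k < j' →
      a i j * a i' j' = a i j' * a i' j) :
    ∃ g h b : ℕ → K, ∀ i j, i < j → a i j = g i * (∏ k ∈ Finset.Ico (i + 1) j, b k) * h j := by
  have hv : ∀ k, ∃ v : ℕ → K, (∀ i ≤ k, ∃ c, ∀ j > k, a i j = c * v j) ∧
      (v = 0 ∨ ∃ i ≤ k, v = a i) := by
    intro k
    by_cases hk : ∃ r ≤ k, ∃ s > k, a r s ≠ 0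
    · obtain ⟨r, hr, s, hs, hrs⟩ := hk
      refine ⟨a r, fun i hi => ⟨a i s / a r s, fun j hj => ?_⟩, Or.inr ⟨r, hr, rfl⟩⟩
      rw [div_mul_eq_mul_div, eq_div_iff hrs, ha k i r j s hi hr hj hs]
    · push Not at hk
      exact ⟨0, fun i hi => ⟨0, fun j hj => by simp [hk i hi j hj]⟩, Or.inl rfl⟩
  choose v hspan hrow using hv
  have hg (i : ℕ) : ∃ c, ∀ j > i, a i j = c * v i j := hspan i i le_rfl
  have hb (k : ℕ) : ∃ c, ∀ j > k, v (k - 1) j = c * v k j := by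
    rcases hrow (k - 1) with h | ⟨r, hr, h⟩
    · exact ⟨0, fun j _ => by simp [h]⟩
    · rw [h]
      exact hspan k r (hr.trans (Nat.sub_le k 1))
  choose g hg using hg
  choose b hb using hb
  refine ⟨g, fun j => v (j - 1) j, b, fun i j hij => ?_⟩
  have key : ∀ m, i + 1 ≤ m → m ≤ j →
      a i j = g i * (∏ k ∈ Finset.Ico (i + 1) m, b k) * v (m - 1) j := by
    intro m hm
    induction m, hm using Nat.le_induction with
    | base => intro _; simpa using hg i j hij
    | succ m hm ih =>
      intro hmj
      rw [ih (by omega), Finset.prod_Ico_succ_top hm, hb m j hmj, Nat.add_sub_cancel]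
      ring
  exact key j hij le_rfl

/-- Any `U ∈ 𝒰_N` (orthogonal with `U - p qᵀ` upper triangular for some
vectors `p, q`) admits upper quasiseparable generators of order one: scalars
`g(i), h(j), b(k)` with `U(i,j) = g(i) b(i+1) ⋯ b(j-1) h(j)` for all `i < j`
(the empty product being `1`). -/
theorem class_U_has_upper_quasiseparable_generators_order_one
    (N : ℕ) (hN : 2 ≤ N) (U : Matrix (Fin N) (Fin N) ℝ)
    (hU : Uᵀ * U = 1)
    (hUclass : ∃ p q : Fin N → ℝ,
      ∀ i j : Fin N, j < i → (U - Matrix.vecMulVec p q) i j = 0) :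
    ∃ g h b : ℕ → ℝ,
      ∀ i j : Fin N, i < j →
        U i j = g (i : ℕ) * (∏ k ∈ Finset.Ico ((i : ℕ) + 1) (j : ℕ), b k) * h (j : ℕ) := by
  obtain ⟨p, q, hpq⟩ := hUclass
  have hlow (i j : Fin N) (hij : j < i) : U i j = p i * q j := by
    simpa [Matrix.vecMulVec_apply, sub_eq_zero] using hpq i j hij
  let a : ℕ → ℕ → ℝ := fun i j => if h : i < N ∧ j < N then U ⟨i, h.1⟩ ⟨j, h.2⟩ else 0
  obtain ⟨g, h, b, hgen⟩ := exists_quasiseparable_generators_of_minors_eq_zero a (by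
    intro k i i' j j' hi hi' hj hj'
    by_cases hjN : j < N
    · by_cases hjN' : j' < N
      · have hiN : i < N := by omega
        have hiN' : i' < N := by omega
        simp only [a, hiN, hiN', hjN, hjN', and_self, dite_true]
        refine Matrix.mul_eq_mul_of_orthogonal_of_compl_block U hU {x | (x : ℕ) ≤ k} p q
          (fun x hx y hy => hlow x y ?_) hi hi' (not_le.mpr hj) (not_le.mpr hj')
        exact Fin.lt_def.mpr (lt_of_le_of_lt hy (not_le.mp hx))
      · simp [a, hjN']
    · simp [a, hjN])
  refine ⟨g, h, b, fun i j hij => ?_⟩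
  simpa [a] using hgen i j hij
end
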